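/- Let A be a proper assignment set for a closed walk W in the brickwall 𝓑. Then t(W) = 1 if and only if every elementary cycle C of (W, A) has t(C) = 1. -/

import Mathlib

open scoped Classical

namespace Hex

/-- Adjacency in the brickwall `𝓑`: vertex `(i,j)` is `b_{i,j}`.
Horizontal edges `b_{i,j} b_{i+1,j}` for all `i,j`, and vertical edges
`b_{i,j} b_{i+1,j+1}` for odd `i`. -/
def bwAdj (u v : ℤ × ℤ) : Prop :=
  (u.2 = v.2 ∧ (v.1 = u.1 + 1 ∨ u.1 = v.1 + 1)) ∨
  (Odd u.1 ∧ v.1 = u.1 + 1 ∧ v.2 = u.2 + 1) ∨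
  (Odd v.1 ∧ u.1 = v.1 + 1 ∧ u.2 = v.2 + 1)

/-- A closed walk of length `k` in the brickwall, represented by a `k`-periodic
function `f : ℤ → ℤ × ℤ` (so `W_i = f i`), with adjacency and no turning back. -/
def IsClosedWalk (k : ℕ) (f : ℤ → ℤ × ℤ) : Prop :=
  0 < k ∧ (∀ i : ℤ, f (i + (k : ℤ)) = f i) ∧ (∀ i : ℤ, bwAdj (f i) (f (i + 1))) ∧
    (∀ i : ℤ, f (i - 1) ≠ f (i + 1))

/-- The neighbor of `v` immediately following `u` in the clockwise order
around `v` in the planar drawing of the brickwall: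
around `b_{i,j}` with `i` odd the clockwise order is
`(b_{i+1,j+1}, b_{i+1,j}, b_{i-1,j})`, and with `i` even it is
`(b_{i+1,j}, b_{i-1,j-1}, b_{i-1,j})`. -/
def cwNext (v u : ℤ × ℤ) : ℤ × ℤ :=
  if v.1 % 2 = 0 then
    (if u = (v.1 + 1, v.2) then (v.1 - 1, v.2 - 1)
     else if u = (v.1 - 1, v.2 - 1) then (v.1 - 1, v.2)
     else (v.1 + 1, v.2))
  else
    (if u = (v.1 + 1, v.2 + 1) then (v.1 + 1, v.2)
     else if u = (v.1 + 1, v.2) then (v.1 - 1, v.2)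
     else (v.1 + 1, v.2 + 1))

/-- `W` makes a right turn at `i`: `W_{i-1}` immediately follows `W_{i+1}` clockwise. -/
def RightTurn (f : ℤ → ℤ × ℤ) (i : ℤ) : Prop := f (i - 1) = cwNext (f i) (f (i + 1))

/-- `W` makes a left turn at `i`: `W_{i+1}` immediately follows `W_{i-1}` clockwise. -/
def LeftTurn (f : ℤ → ℤ × ℤ) (i : ℤ) : Prop := f (i + 1) = cwNext (f i) (f (i - 1))

noncomputable def rightCount (k : ℕ) (f : ℤ → ℤ × ℤ) : ℕ :=
  ((Finset.range k).filter fun t => RightTurn f (t : ℤ)).card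

noncomputable def leftCount (k : ℕ) (f : ℤ → ℤ × ℤ) : ℕ :=
  ((Finset.range k).filter fun t => LeftTurn f (t : ℤ)).card

/-- The turning number `t(W) = (Right(W) - Left(W))/6`. -/
noncomputable def turningNumber (k : ℕ) (f : ℤ → ℤ × ℤ) : ℚ :=
  ((rightCount k f : ℚ) - (leftCount k f : ℚ)) / 6

/-- `uv` is a horizontal right edge: same height, smaller first coordinate even. -/
def HorizRight (u v : ℤ × ℤ) : Prop := u.2 = v.2 ∧ Even (min u.1 v.1)

/-- `uv` is a horizontal left edge: same height, smaller first coordinate odd. -/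
def HorizLeft (u v : ℤ × ℤ) : Prop := u.2 = v.2 ∧ Odd (min u.1 v.1)

/-- A right-turn walk: every vertical edge is immediately followed by a horizontal
right edge and immediately preceded by a horizontal left edge. -/
def IsRightTurnWalk (f : ℤ → ℤ × ℤ) : Prop :=
  ∀ i : ℤ, (f i).2 ≠ (f (i + 1)).2 →
    HorizRight (f (i + 1)) (f (i + 2)) ∧ HorizLeft (f (i - 1)) (f i)

/-- The unique neighbor of `W_i` other than `W_{i-1}` and `W_{i+1}`. -/
def thirdNb (f : ℤ → ℤ × ℤ) (i : ℤ) : ℤ × ℤ :=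
  if cwNext (f i) (f (i + 1)) = f (i - 1) then cwNext (f i) (f (i - 1))
  else cwNext (f i) (f (i + 1))

/-- `i ∈ {0,…,k-1}` is a PA-index: `W` makes a left turn at `i` and the third
neighbor of `W_i` has the same height as `W_i`. -/
def IsPAIndex (k : ℕ) (f : ℤ → ℤ × ℤ) (i : ℤ) : Prop :=
  0 ≤ i ∧ i < (k : ℤ) ∧ LeftTurn f i ∧ (thirdNb f i).2 = (f i).2

/-- The horizontal path in the brickwall from `u` to `v` (same height), as a list. -/
def horizPath (u v : ℤ × ℤ) : List (ℤ × ℤ) :=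
  if u.1 ≤ v.1 then (List.range ((v.1 - u.1).toNat + 1)).map fun t => (u.1 + (t : ℤ), u.2)
  else (List.range ((u.1 - v.1).toNat + 1)).map fun t => (u.1 - (t : ℤ), u.2)

/-- `p = {x,y}` is a possible assignment (PA) of the closed walk. -/
def IsPA (k : ℕ) (f : ℤ → ℤ × ℤ) (p : Finset ℤ) : Prop :=
  ∃ x y : ℤ, p = {x, y} ∧ IsPAIndex k f x ∧ IsPAIndex k f y ∧
    f x ≠ f y ∧ (f x).2 = (f y).2 ∧
    ∀ z ∈ horizPath (f x) (f y),
      z ≠ f (x - 1) ∧ z ≠ f (x + 1) ∧ z ≠ f (y - 1) ∧ z ≠ f (y + 1)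

/-- A proper assignment set: a set of PAs forming a non-crossing perfect matching
on the PA-indices. -/
def IsProperAssignment (k : ℕ) (f : ℤ → ℤ × ℤ) (A : Set (Finset ℤ)) : Prop :=
  (∀ p ∈ A, IsPA k f p) ∧
  (∀ i : ℤ, IsPAIndex k f i → ∃! p, p ∈ A ∧ i ∈ p) ∧
  (∀ p ∈ A, ∀ q ∈ A, ∀ i ∈ p, ∀ j ∈ p, ∀ x ∈ q, ∀ y ∈ q, ¬(i < x ∧ x < j ∧ j < y))

/-- `n(i)`: the first PA-index strictly after `i` in cyclic order
(minimizing the cyclic distance `((j - i - 1) mod k) + 1`). -/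
noncomputable def nextPA (k : ℕ) (f : ℤ → ℤ × ℤ) (i : ℤ) : ℤ :=
  if h : ∃ j : ℤ, IsPAIndex k f j ∧ ∀ j' : ℤ, IsPAIndex k f j' →
      (j - i - 1) % (k : ℤ) ≤ (j' - i - 1) % (k : ℤ)
  then h.choose else 0

/-- The subwalk `W_{x,y}` of the closed walk, as a list of `((y-x) mod k) + 1` vertices. -/
def subwalkList (k : ℕ) (f : ℤ → ℤ × ℤ) (x y : ℤ) : List (ℤ × ℤ) :=
  (List.range (((y - x) % (k : ℤ)).toNat + 1)).map fun t => f (x + (t : ℤ))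

/-- The cyclic function `ℤ → ℤ × ℤ` determined by a list of vertices. -/
def listFun (L : List (ℤ × ℤ)) : ℤ → ℤ × ℤ :=
  fun z => L.getD ((z % (L.length : ℤ)).toNat) (0, 0)

/-- An elementary cycle of `(W, A)`, given by its index sequence
`i_0, …, i_l` of PA-indices with `{n(i_t), i_{t+1}} ∈ A`, `{n(i_l), i_0} ∈ A`,
and canonical rotation `i_0 < i_t` for `t ≥ 1`. -/
structure ElemCycle (k : ℕ) (f : ℤ → ℤ × ℤ) (A : Set (Finset ℤ)) where
  l : ℕ
  idx : ℕ → ℤ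
  pa : ∀ t : ℕ, t ≤ l → IsPAIndex k f (idx t)
  mem : ∀ t : ℕ, t < l → ({nextPA k f (idx t), idx (t + 1)} : Finset ℤ) ∈ A
  memLast : ({nextPA k f (idx l), idx 0} : Finset ℤ) ∈ A
  minimal : ∀ t : ℕ, 1 ≤ t → t ≤ l → idx 0 < idx t
  canon : ∀ t : ℕ, l < t → idx t = idx 0

/-- The `t`-th segment `W_{i_t, n(i_t)} ∘ H_{n(i_t), i_{t+1}}` of an elementary
cycle (with final vertex dropped, for concatenation). -/
noncomputable def ecSegment {k : ℕ} {f : ℤ → ℤ × ℤ} {A : Set (Finset ℤ)}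
    (E : ElemCycle k f A) (t : ℕ) : List (ℤ × ℤ) :=
  (subwalkList k f (E.idx t) (nextPA k f (E.idx t))).dropLast ++
  (horizPath (f (nextPA k f (E.idx t))) (f (E.idx (if t = E.l then 0 else t + 1)))).dropLast

/-- The closed walk `C = W_{i_0,n(i_0)} ∘ H_{n(i_0),i_1} ∘ ⋯ ∘ H_{n(i_l),i_0}` of an
elementary cycle, as a list (without the repeated final vertex). -/
noncomputable def ecOpenList {k : ℕ} {f : ℤ → ℤ × ℤ} {A : Set (Finset ℤ)}
    (E : ElemCycle k f A) : List (ℤ × ℤ) :=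
  (List.range (E.l + 1)).flatMap (ecSegment E)

/-- The length of the closed walk of an elementary cycle. -/
noncomputable def ecLen {k : ℕ} {f : ℤ → ℤ × ℤ} {A : Set (Finset ℤ)}
    (E : ElemCycle k f A) : ℕ := (ecOpenList E).length

/-- The closed walk of an elementary cycle, as a periodic function. -/
noncomputable def ecFun {k : ℕ} {f : ℤ → ℤ × ℤ} {A : Set (Finset ℤ)}
    (E : ElemCycle k f A) : ℤ → ℤ × ℤ := listFun (ecOpenList E)

/-- `(m, g)` is (the closed walk of) an elementary cycle of `(W, A)`; if `A = ∅`
and `W` has no PA-index, `W` itself is the unique elementary cycle. -/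
def IsElemCycleWalk (k : ℕ) (f : ℤ → ℤ × ℤ) (A : Set (Finset ℤ))
    (m : ℕ) (g : ℤ → ℤ × ℤ) : Prop :=
  (∃ E : ElemCycle k f A, m = ecLen E ∧ g = ecFun E) ∨
  (A = ∅ ∧ (∀ i : ℤ, ¬ IsPAIndex k f i) ∧ m = k ∧ g = f)

/-- The number of elementary cycles of `(W, A)` (elementary cycles being
identified with their index sequences). -/
noncomputable def numElemCycles (k : ℕ) (f : ℤ → ℤ × ℤ) (A : Set (Finset ℤ)) : ℕ :=
  if A = ∅ ∧ ∀ i : ℤ, ¬ IsPAIndex k f i then 1 else Nat.card (ElemCycle k f A)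

/-- The number of PA-indices of the closed walk. -/
noncomputable def paCount (k : ℕ) (f : ℤ → ℤ × ℤ) : ℕ :=
  Nat.card {i : ℤ // IsPAIndex k f i}

/-- The walk `W' = W_{0,y} ∘ H_{y,0}`, as a list (without repeated final vertex). -/
noncomputable def splitList (k : ℕ) (f : ℤ → ℤ × ℤ) (y : ℤ) : List (ℤ × ℤ) :=
  (subwalkList k f 0 y).dropLast ++ (horizPath (f y) (f 0)).dropLast

/-- The length of the walk `W' = W_{0,y} ∘ H_{y,0}`. -/
noncomputable def splitLen (k : ℕ) (f : ℤ → ℤ × ℤ) (y : ℤ) : ℕ := (splitList k f y).length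

/-- The walk `W' = W_{0,y} ∘ H_{y,0}`, as a periodic function. -/
noncomputable def splitFun (k : ℕ) (f : ℤ → ℤ × ℤ) (y : ℤ) : ℤ → ℤ × ℤ :=
  listFun (splitList k f y)

/-- `Σ_{C ∈ 𝒞} (t(C) - 1)` over the set `𝒞` of elementary cycles of `(W, A)`. -/
noncomputable def elemTurnSum (k : ℕ) (f : ℤ → ℤ × ℤ) (A : Set (Finset ℤ)) : ℚ :=
  if A = ∅ ∧ ∀ i : ℤ, ¬ IsPAIndex k f i then turningNumber k f - 1
  else ∑ᶠ E : ElemCycle k f A, (turningNumber (ecLen E) (ecFun E) - 1)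

section Local

/-- `+1` for a right turn `a, b, c` and `-1` for a left turn. -/
noncomputable def turn (a b c : ℤ × ℤ) : ℤ :=
  (if a = cwNext b c then 1 else 0) - (if c = cwNext b a then 1 else 0)

/-- `a, b, c` is a walk without turning back, and is not a left turn between a horizontal and a
vertical edge. -/
def Good (a b c : ℤ × ℤ) : Prop :=
  bwAdj a b ∧ bwAdj b c ∧ a ≠ c ∧ ¬(c = cwNext b a ∧ (cwNext b c).2 = b.2)

/-- Indicator of the triples that are not `Good`. -/
noncomputable def badInd (a b c : ℤ × ℤ) : ℤ := if Good a b c then 0 else 1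

/-- Indicator of the vertical edges. -/
noncomputable def vert (a b : ℤ × ℤ) : ℤ := if a.2 = b.2 then 0 else 1

/-- A potential on directed edges whose variation along a `Good` walk measures the turning, up to
a contribution of `3` for each vertical edge. -/
noncomputable def phase (a b : ℤ × ℤ) : ℤ :=
  if a.2 ≠ b.2 then 0
  else if a.1 % 2 = 0 then (if b.1 = a.1 + 1 then 1 else 2)
  else (if b.1 = a.1 + 1 then 2 else 1)

lemma bwAdj_symm {u v : ℤ × ℤ} (h : bwAdj u v) : bwAdj v u := by
  unfold bwAdj at *
  tauto

/-- The neighbors of a vertex with even first coordinate. -/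
lemma bwAdj_even {x y : ℤ} {v : ℤ × ℤ} (hx : x % 2 = 0) (h : bwAdj (x, y) v) :
    v = (x + 1, y) ∨ v = (x - 1, y - 1) ∨ v = (x - 1, y) := by
  obtain ⟨p, q⟩ := v
  simp only [bwAdj, Prod.mk.injEq, Int.odd_iff] at *
  omega

/-- The neighbors of a vertex with odd first coordinate. -/
lemma bwAdj_odd {x y : ℤ} {v : ℤ × ℤ} (hx : ¬ x % 2 = 0) (h : bwAdj (x, y) v) :
    v = (x + 1, y + 1) ∨ v = (x + 1, y) ∨ v = (x - 1, y) := by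
  obtain ⟨p, q⟩ := v
  simp only [bwAdj, Prod.mk.injEq, Int.odd_iff] at *
  omega

lemma turn_swap (a b c : ℤ × ℤ) : turn c b a = -turn a b c := by
  unfold turn
  ring

lemma turn_eq_phase {a b c : ℤ × ℤ} (h : Good a b c) :
    turn a b c = phase b c - phase a b + 3 * vert b c := by
  obtain ⟨hab, hbc, hac, hl⟩ := h
  obtain ⟨x, y⟩ := b
  have hy : ¬ y = y - 1 := by omega
  by_cases hx : x % 2 = 0
  · have h1 : (x + 1) % 2 ≠ 0 := by omega
    have h2 : (x - 1) % 2 ≠ 0 := by omega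
    have h3 : ¬ x - 1 = x + 1 := by omega
    have h4 : ¬ x + 1 = x - 1 := by omega
    have h5 : ¬ x = x + 1 + 1 := by omega
    rcases bwAdj_even hx (bwAdj_symm hab) with rfl | rfl | rfl <;>
      rcases bwAdj_even hx hbc with rfl | rfl | rfl <;>
      revert hac hl <;> clear hab hbc <;>
      simp [turn, phase, vert, cwNext, hx, h1, h2, h3, h4, h5, hy]
  · have h1 : (x + 1) % 2 = 0 := by omega
    have h2 : (x - 1) % 2 = 0 := by omega
    have h3 : ¬ x - 1 = x + 1 := by omega
    have h4 : ¬ x + 1 = x - 1 := by omega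
    have h5 : ¬ x = x + 1 + 1 := by omega
    rcases bwAdj_odd hx (bwAdj_symm hab) with rfl | rfl | rfl <;>
      rcases bwAdj_odd hx hbc with rfl | rfl | rfl <;>
      revert hac hl <;> clear hab hbc <;>
      simp [turn, phase, vert, cwNext, hx, h1, h2, h3, h4, h5]

/-- Replacing one of the two edges of a left turn by the third edge at the vertex gives a right
turn. -/
lemma turn_of_left {a b c h : ℤ × ℤ} (hab : bwAdj a b) (hbc : bwAdj b c) (hac : a ≠ c)
    (hl : c = cwNext b a) (hh : bwAdj b h) (hha : h ≠ a) (hhc : h ≠ c) :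
    turn a b c = -1 ∧ turn a b h = 1 ∧ turn h b c = 1 ∧ Good a b h ∧ Good h b c := by
  have hhb := bwAdj_symm hh
  suffices turn a b c = -1 ∧ turn a b h = 1 ∧ turn h b c = 1 ∧
      ¬(h = cwNext b a ∧ (cwNext b h).2 = b.2) ∧ ¬(c = cwNext b h ∧ (cwNext b c).2 = b.2) from
    ⟨this.1, this.2.1, this.2.2.1, ⟨hab, hh, hha.symm, this.2.2.2.1⟩, ⟨hhb, hbc, hhc, this.2.2.2.2⟩⟩
  clear hhb
  obtain ⟨x, y⟩ := b
  have hy : ¬ y = y - 1 := by omega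
  by_cases hx : x % 2 = 0
  · have h3 : ¬ x - 1 = x + 1 := by omega
    have h4 : ¬ x + 1 = x - 1 := by omega
    rcases bwAdj_even hx (bwAdj_symm hab) with rfl | rfl | rfl <;>
      rcases bwAdj_even hx hbc with rfl | rfl | rfl <;>
      rcases bwAdj_even hx hh with rfl | rfl | rfl <;>
      revert hac hl hha hhc <;> clear hab hbc hh <;>
      simp [turn, cwNext, hx, h3, h4, hy]
  · have h3 : ¬ x - 1 = x + 1 := by omega
    have h4 : ¬ x + 1 = x - 1 := by omega
    rcases bwAdj_odd hx (bwAdj_symm hab) with rfl | rfl | rfl <;>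
      rcases bwAdj_odd hx hbc with rfl | rfl | rfl <;>
      rcases bwAdj_odd hx hh with rfl | rfl | rfl <;>
      revert hac hl hha hhc <;> clear hab hbc hh <;>
      simp [turn, cwNext, hx, h3, h4]

lemma good_straight_right (x y : ℤ) : Good (x, y) (x + 1, y) (x + 2, y) := by
  have h2 : x + 2 = x + 1 + 1 := by omega
  have h3 : ¬ x = x + 1 + 1 := by omega
  by_cases hx : (x + 1) % 2 = 0 <;> simp [Good, bwAdj, cwNext, hx, h2, h3]

lemma good_straight_left (x y : ℤ) : Good (x, y) (x - 1, y) (x - 2, y) := by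
  have h2 : x - 2 = x - 1 - 1 := by omega
  have h3 : ¬ x = x - 1 - 1 := by omega
  have h4 : ¬ x - 1 - 1 = x := by omega
  have h5 : ¬ y = y - 1 := by omega
  by_cases hx : (x - 1) % 2 = 0 <;> simp [Good, bwAdj, cwNext, hx, h2, h3, h4, h5]

/-- An index of a walk that is not of the kind counted by `IsPAIndex` carries a `Good` triple. -/
lemma good_of_not_left {f : ℤ → ℤ × ℤ} {i : ℤ} (hab : bwAdj (f (i - 1)) (f i))
    (hbc : bwAdj (f i) (f (i + 1))) (hac : f (i - 1) ≠ f (i + 1))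
    (h : ¬(LeftTurn f i ∧ (thirdNb f i).2 = (f i).2)) :
    Good (f (i - 1)) (f i) (f (i + 1)) := by
  refine ⟨hab, hbc, hac, fun ⟨h1, h2⟩ => h ⟨h1, ?_⟩⟩
  have key : cwNext (f i) (f (i + 1)) ≠ f (i - 1) := by
    revert hab hbc hac h1
    generalize f (i - 1) = a
    generalize f (i + 1) = c
    generalize f i = b
    intro hab hbc hac h1
    obtain ⟨x, y⟩ := b
    have hy : ¬ y = y - 1 := by omega
    have h3 : ¬ x - 1 = x + 1 := by omega
    have h4 : ¬ x + 1 = x - 1 := by omega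
    by_cases hx : x % 2 = 0
    · rcases bwAdj_even hx (bwAdj_symm hab) with rfl | rfl | rfl <;>
        rw [h1] <;> simp [cwNext, hx, h3, h4, hy]
    · rcases bwAdj_odd hx (bwAdj_symm hab) with rfl | rfl | rfl <;>
        rw [h1] <;> simp [cwNext, hx, h3, h4]
  rw [thirdNb, if_neg key]
  exact h2

end Local

section CyclicSums

/-- The sum of `F` over the consecutive triples of a closed walk of length `m`. -/
def cycSum (F : ℤ × ℤ → ℤ × ℤ → ℤ × ℤ → ℤ) (m : ℕ) (g : ℤ → ℤ × ℤ) : ℤ :=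
  ∑ t ∈ Finset.range m, F (g (t - 1)) (g t) (g (t + 1))

lemma turningNumber_eq_cycSum (m : ℕ) (g : ℤ → ℤ × ℤ) :
    turningNumber m g = (cycSum turn m g : ℚ) / 6 := by
  have hrange : (do let a ← Finset.range m; pure (a : ℤ) : Finset ℤ) =
      (Finset.range m).image (fun a : ℕ => (a : ℤ)) := by
    ext z
    simp [Finset.bind_def, Finset.pure_def, eq_comm]
  have hinj : Set.InjOn (fun a : ℕ => (a : ℤ)) (Finset.range m) := fun _ _ _ _ h => Int.ofNat_inj.1 h
  rw [turningNumber, rightCount, leftCount, hrange, Finset.card_filter, Finset.card_filter,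
    Finset.sum_image hinj, Finset.sum_image hinj]
  simp only [cycSum, turn, Finset.sum_sub_distrib, RightTurn, LeftTurn]
  push_cast
  congr 2 <;> refine Finset.sum_congr rfl fun t _ => ?_ <;> split_ifs <;> simp_all

lemma turningNumber_eq_one_iff (m : ℕ) (g : ℤ → ℤ × ℤ) :
    turningNumber m g = 1 ↔ cycSum turn m g = 6 := by
  rw [turningNumber_eq_cycSum, div_eq_iff (by norm_num), one_mul]
  norm_cast

/-- A closed walk with only `Good` triples has turning number at least one. -/
lemma six_le_cycSum_turn {m : ℕ} {g : ℤ → ℤ × ℤ} (hm : 0 < m) (hper : ∀ z, g (z + m) = g z)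
    (hgood : ∀ z, Good (g (z - 1)) (g z) (g (z + 1))) : 6 ≤ cycSum turn m g := by
  have hadj : ∀ z, bwAdj (g z) (g (z + 1)) := fun z => (hgood z).2.1
  have hsum : cycSum turn m g = 3 * ∑ t ∈ Finset.range m, vert (g t) (g (t + 1)) := by
    have h0 := Finset.sum_range_sub (fun t : ℕ => phase (g ((t : ℤ) - 1)) (g t)) m
    have h1 : g m = g 0 := by simpa using hper 0
    have h2 : g ((m : ℤ) - 1) = g (-1) := by rw [← hper (-1), neg_add_eq_sub]
    simp only [h1, h2, Nat.cast_zero, zero_sub, sub_self] at h0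
    rw [cycSum, Finset.mul_sum, ← sub_eq_zero, ← Finset.sum_sub_distrib, ← h0]
    refine Finset.sum_congr rfl fun t _ => ?_
    rw [turn_eq_phase (hgood t)]
    push_cast
    simp
  have hnonneg : ∀ t ∈ Finset.range m, 0 ≤ vert (g t) (g ((t : ℤ) + 1)) := by
    intro t _
    unfold vert
    split_ifs <;> norm_num
  have heven : (∑ t ∈ Finset.range m, vert (g t) (g (t + 1))) % 2 = 0 := by
    have h0 := Finset.sum_range_sub (fun t : ℕ => (g t).2) m
    have h1 : g m = g 0 := by simpa using hper 0
    simp only [h1, Nat.cast_zero, sub_self] at h0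
    have h2 : (2 : ℤ) ∣ ∑ t ∈ Finset.range m,
        (vert (g t) (g (t + 1)) - ((g ((t + 1 : ℕ) : ℤ)).2 - (g t).2)) := by
      refine Finset.dvd_sum fun t _ => ?_
      have := hadj t
      push_cast
      unfold vert bwAdj at *
      split_ifs <;> omega
    rw [Finset.sum_sub_distrib, h0] at h2
    omega
  have hpos : ∑ t ∈ Finset.range m, vert (g t) (g (t + 1)) ≠ 0 := by
    intro h0
    rw [Finset.sum_eq_zero_iff_of_nonneg hnonneg] at h0
    have hflat : ∀ t : ℕ, t < m → (g t).2 = (g (t + 1)).2 := by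
      intro t ht
      have := h0 t (Finset.mem_range.2 ht)
      unfold vert at this
      by_contra h
      simp [h] at this
    have hline : ∀ t : ℕ, t + 1 ≤ m →
        g (t + 1) = ((g 0).1 + (t + 1) * ((g 1).1 - (g 0).1), (g 0).2) ∧
        (g (t + 1)).1 - (g t).1 = (g 1).1 - (g 0).1 := by
      intro t
      induction t with
      | zero =>
        intro h
        have := hflat 0 h
        simp only [Nat.cast_zero, zero_add] at this ⊢
        refine ⟨?_, trivial⟩
        ext <;> simp [this]
      | succ t ih =>
        intro h
        obtain ⟨h1, h2⟩ := ih (by omega)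
        have h3 := hflat (t + 1) h
        have h4 := hflat t (by omega)
        have h5 := hadj ((t + 1 : ℕ) : ℤ)
        have h6 := hadj t
        have h7 := (hgood ((t + 1 : ℕ) : ℤ)).2.2.1
        push_cast at *
        simp only [add_sub_cancel_right] at h7
        have h8 : (g ((t : ℤ) + 1 + 1)).1 ≠ (g t).1 := fun h => h7 (Prod.ext h.symm (by omega))
        have h9 : (g ((t : ℤ) + 1 + 1)).1 - (g (t + 1)).1 = (g 1).1 - (g 0).1 := by
          unfold bwAdj at h5 h6
          omega
        refine ⟨?_, h9⟩
        rw [h1] at h9 h3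
        ext
        · simp only at h9 ⊢
          linarith
        · exact h3.symm
    have h1 := (hline (m - 1) (by omega)).1
    have h2 : ((m - 1 : ℕ) : ℤ) + 1 = m := by omega
    rw [h2, show g m = g 0 by simpa using hper 0] at h1
    have h3 := congrArg Prod.fst h1
    simp only [left_eq_add, mul_eq_zero] at h3
    have h4 := hadj 0
    have h5 := hflat 0 hm
    unfold bwAdj at h4
    simp only [Nat.cast_zero, zero_add] at h4 h5
    omega
  have := Finset.sum_nonneg hnonneg
  rw [hsum]
  omega

end CyclicSums

section TripleSums

variable (F : ℤ × ℤ → ℤ × ℤ → ℤ × ℤ → ℤ)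

/-- The sum of `F` over the consecutive triples of a list. -/
def tripleSum : List (ℤ × ℤ) → ℤ
  | a :: b :: c :: l => F a b c + tripleSum (b :: c :: l)
  | _ => 0

lemma tripleSum_append (P Q : List (ℤ × ℤ)) (u v : ℤ × ℤ) :
    tripleSum F (P ++ u :: v :: Q) = tripleSum F (P ++ [u, v]) + tripleSum F (u :: v :: Q) := by
  induction P with
  | nil => simp [tripleSum]
  | cons a P ih =>
    rcases P with _ | ⟨b, _ | ⟨c, P⟩⟩
    · simp [tripleSum]
    · simp [tripleSum, add_assoc]
    · simp only [List.cons_append, tripleSum, add_assoc] at ih ⊢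
      rw [ih]

lemma tripleSum_append_singleton (P : List (ℤ × ℤ)) (u v w : ℤ × ℤ) :
    tripleSum F (P ++ [u, v] ++ [w]) = tripleSum F (P ++ [u, v]) + F u v w := by
  rw [List.append_assoc]
  simp [tripleSum_append F P [w] u v, tripleSum]

lemma tripleSum_reverse (L : List (ℤ × ℤ)) :
    tripleSum F L.reverse = tripleSum (fun a b c => F c b a) L := by
  induction L with
  | nil => rfl
  | cons a L ih =>
    rcases L with _ | ⟨b, _ | ⟨c, L⟩⟩
    · rfl
    · rfl
    · rw [tripleSum, ← ih, add_comm]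
      have := tripleSum_append_singleton F L.reverse c b a
      simpa using this

lemma tripleSum_map_range (m : ℕ) (g : ℕ → ℤ × ℤ) :
    tripleSum F ((List.range (m + 2)).map g) =
      ∑ t ∈ Finset.range m, F (g t) (g (t + 1)) (g (t + 2)) := by
  induction m with
  | zero => simp [tripleSum, List.range_succ]
  | succ m ih =>
    rw [Finset.sum_range_succ, ← ih]
    have := tripleSum_append_singleton F ((List.range m).map g) (g m) (g (m + 1)) (g (m + 2))
    simpa [List.range_succ] using this

lemma tripleSum_congr_zero {m : ℕ} {g : ℕ → ℤ × ℤ}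
    (h : ∀ t, F (g t) (g (t + 1)) (g (t + 2)) = 0) :
    tripleSum F ((List.range m).map g) = 0 := by
  rcases m with _ | _ | m
  · rfl
  · rfl
  · rw [tripleSum_map_range]
    exact Finset.sum_eq_zero fun t _ => h t

lemma cycSum_listFun {L : List (ℤ × ℤ)} {a b : ℤ × ℤ} {r : List (ℤ × ℤ)} (hL : L = a :: b :: r) :
    cycSum F L.length (listFun L) = tripleSum F (L ++ [a, b]) := by
  have hlen : 0 < L.length := by simp [hL]
  have hper : ∀ z : ℤ, listFun L (z + L.length) = listFun L z := by
    intro z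
    simp [listFun]
  have hlist : L ++ [a, b] = (List.range (L.length + 2)).map fun t : ℕ => listFun L (t : ℤ) := by
    have h0 : listFun L 0 = a := by simp [listFun, hL]
    have h1 : listFun L 1 = b := by
      have : (1 : ℤ) % (L.length : ℤ) = 1 := by
        apply Int.emod_eq_of_lt <;> simp [hL]
      rw [listFun, this]
      simp [hL]
    rw [List.range_add, List.map_append]
    congr 1
    · refine List.ext_getElem (by simp) fun t h1 h2 => ?_
      have h3 : ((t : ℤ) % (L.length : ℤ)).toNat = t := by
        rw [Int.emod_eq_of_lt (by omega) (by omega)]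
        simp
      simp [listFun, h3, h1]
    · have h2 := hper 0
      have h3 := hper 1
      rw [zero_add] at h2
      rw [add_comm] at h3
      simp [List.range_succ, h2, h3, h0, h1]
  rw [hlist, tripleSum_map_range, cycSum]
  obtain ⟨m, hm⟩ : ∃ m, L.length = m + 1 := ⟨L.length - 1, by omega⟩
  rw [hm, Finset.sum_range_succ', Finset.sum_range_succ]
  have hpm : ∀ z : ℤ, listFun L (z + (m + 1)) = listFun L z := by
    intro z
    rw [← hper z, hm]
    push_cast
    rfl
  congr 1
  · refine Finset.sum_congr rfl fun t _ => ?_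
    push_cast
    simp [add_assoc]
  · have h1 := hpm (-1)
    have h2 := hpm 0
    have h3 := hpm 1
    rw [show (-1 : ℤ) + (m + 1) = m by ring] at h1
    rw [zero_add] at h2
    rw [show (1 : ℤ) + (m + 1) = m + 2 by ring] at h3
    push_cast
    simp [h1, h2, h3]

lemma tripleSum_flatMap (N : ℕ) (seg : ℕ → List (ℤ × ℤ)) (a b : ℕ → ℤ × ℤ)
    (h : ∀ t ≤ N, ∃ r, seg t = a t :: b t :: r) :
    tripleSum F ((List.range (N + 1)).flatMap seg ++ [a (N + 1), b (N + 1)]) =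
      ∑ t ∈ Finset.range (N + 1), tripleSum F (seg t ++ [a (t + 1), b (t + 1)]) := by
  induction N with
  | zero => simp
  | succ N ih =>
    rw [Finset.sum_range_succ, ← ih fun t ht => h t (by omega), List.range_succ,
      List.flatMap_append]
    obtain ⟨r, hr⟩ := h (N + 1) le_rfl
    have := tripleSum_append F ((List.range (N + 1)).flatMap seg)
      (r ++ [a (N + 1 + 1), b (N + 1 + 1)]) (a (N + 1)) (b (N + 1))
    simpa [hr] using this

end TripleSums

section HorizPath

lemma horizPath_eq (u v : ℤ × ℤ) : horizPath u v =
    if u.1 ≤ v.1 then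
      (List.range ((v.1 - u.1).toNat + 1)).map fun t : ℕ => (u.1 + (t : ℤ), u.2)
    else (List.range ((u.1 - v.1).toNat + 1)).map fun t : ℕ => (u.1 - (t : ℤ), u.2) := by
  unfold horizPath
  split_ifs <;> simp [← List.map_eq_flatMap]

lemma subwalkList_eq (k : ℕ) (f : ℤ → ℤ × ℤ) (x y : ℤ) : subwalkList k f x y =
    (List.range (((y - x) % (k : ℤ)).toNat + 1)).map fun t : ℕ => f (x + (t : ℤ)) := by
  unfold subwalkList
  simp [← List.map_eq_flatMap]

/-- The neighbor of `u` in the direction of a vertex `v` of the same height. -/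
def towards (u v : ℤ × ℤ) : ℤ × ℤ := if u.1 ≤ v.1 then (u.1 + 1, u.2) else (u.1 - 1, u.2)

lemma bwAdj_towards (u v : ℤ × ℤ) : bwAdj u (towards u v) := by
  unfold towards bwAdj
  split_ifs <;> simp

lemma horizPath_eq_cons {u v : ℤ × ℤ} (hne : u ≠ v) (h : u.2 = v.2) :
    ∃ r, horizPath u v = u :: towards u v :: r := by
  have h1 : u.1 ≠ v.1 := fun h' => hne (Prod.ext h' h)
  rw [horizPath_eq, towards]
  split_ifs with hle
  · obtain ⟨d, hd⟩ : ∃ d, (v.1 - u.1).toNat = d + 1 := ⟨(v.1 - u.1).toNat - 1, by omega⟩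
    rw [hd, List.range_succ_eq_map, List.range_succ_eq_map]
    simp
  · obtain ⟨d, hd⟩ : ∃ d, (u.1 - v.1).toNat = d + 1 := ⟨(u.1 - v.1).toNat - 1, by omega⟩
    rw [hd, List.range_succ_eq_map, List.range_succ_eq_map]
    simp

lemma horizPath_reverse {u v : ℤ × ℤ} (hne : u ≠ v) (h : u.2 = v.2) :
    (horizPath u v).reverse = horizPath v u := by
  have h1 : u.1 ≠ v.1 := fun h' => hne (Prod.ext h' h)
  rw [horizPath_eq, horizPath_eq]
  split_ifs with h2 h3 h3
  · omega
  · refine List.ext_getElem (by simp) fun t h4 h5 => ?_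
    simp only [List.length_reverse, List.length_map, List.length_range] at h4
    simp only [List.getElem_reverse, List.length_map, List.length_range, List.getElem_map,
      List.getElem_range, Prod.mk.injEq, h, and_true]
    omega
  · refine List.ext_getElem (by simp) fun t h4 h5 => ?_
    simp only [List.length_reverse, List.length_map, List.length_range] at h4
    simp only [List.getElem_reverse, List.length_map, List.length_range, List.getElem_map,
      List.getElem_range, Prod.mk.injEq, h, and_true]
    omega
  · omega

lemma horizPath_eq_append {u v : ℤ × ℤ} (hne : u ≠ v) (h : u.2 = v.2) :
    ∃ r, horizPath u v = r ++ [towards v u, v] := by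
  obtain ⟨r, hr⟩ := horizPath_eq_cons hne.symm h.symm
  refine ⟨r.reverse, ?_⟩
  rw [← horizPath_reverse hne.symm h.symm, hr]
  simp

lemma tripleSum_turn_horizPath {u v : ℤ × ℤ} (hne : u ≠ v) (h : u.2 = v.2) :
    tripleSum turn (horizPath v u) = -tripleSum turn (horizPath u v) := by
  rw [← horizPath_reverse hne h, tripleSum_reverse]
  generalize horizPath u v = L
  induction L with
  | nil => rfl
  | cons a L ih =>
    rcases L with _ | ⟨b, _ | ⟨c, L⟩⟩
    · rfl
    · rfl
    · simp only [tripleSum] at ih ⊢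
      rw [ih, turn_swap]
      ring

lemma tripleSum_badInd_horizPath (u v : ℤ × ℤ) : tripleSum badInd (horizPath u v) = 0 := by
  rw [horizPath_eq]
  split_ifs
  · refine tripleSum_congr_zero badInd fun t => if_pos ?_
    have := good_straight_right (u.1 + t) u.2
    push_cast
    simpa only [add_assoc] using this
  · refine tripleSum_congr_zero badInd fun t => if_pos ?_
    have := good_straight_left (u.1 - t) u.2
    push_cast
    simpa only [sub_sub] using this

end HorizPath

section Orbits

/-- The elements that are least in their orbit under `s`. -/
noncomputable def orbitMins {α : Type*} [Fintype α] [LinearOrder α] (s : α → α) : Finset α :=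
  Finset.univ.filter fun m => ∀ t : ℕ, m ≤ s^[t] m

/-- In a finite type an injective self-map can be undone by iterating it. -/
lemma exists_iterate_iterate_eq {α : Type*} [Finite α] {s : α → α} (hs : Function.Injective s)
    (x : α) (t : ℕ) :
    ∃ u : ℕ, s^[u] (s^[t] x) = x := by
  have hp : 0 < Function.minimalPeriod s x :=
    Function.minimalPeriod_pos_of_mem_periodicPts (hs.mem_periodicPts x)
  refine ⟨Function.minimalPeriod s x * t - t, ?_⟩
  rw [← Function.iterate_add_apply, Nat.sub_add_cancel (Nat.le_mul_of_pos_left _ hp)]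
  exact (Function.isPeriodicPt_minimalPeriod s x).mul_const t

/-- Summing over the orbits, each traversed from its least element, is summing over everything. -/
lemma sum_orbitMins {α : Type*} [Fintype α] [LinearOrder α] {s : α → α}
    (hs : Function.Injective s) (g : α → ℤ) :
    ∑ m ∈ orbitMins s, ∑ t ∈ Finset.range (Function.minimalPeriod s m), g (s^[t] m) =
      ∑ x, g x := by
  rw [Finset.sum_sigma']
  refine Finset.sum_bij (fun p _ => s^[p.2] p.1) (fun _ _ => Finset.mem_univ _) ?_ ?_
    (fun _ _ => rfl)
  · rintro ⟨m, t⟩ hm ⟨m', t'⟩ hm' h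
    simp only [orbitMins, Finset.mem_sigma, Finset.mem_filter, Finset.mem_univ, true_and,
      Finset.mem_range] at hm hm' h
    have hmm : m = m' := by
      obtain ⟨u, hu⟩ := exists_iterate_iterate_eq hs m t
      obtain ⟨u', hu'⟩ := exists_iterate_iterate_eq hs m' t'
      rw [h, ← Function.iterate_add_apply] at hu
      rw [← h, ← Function.iterate_add_apply] at hu'
      exact le_antisymm (hu' ▸ hm.1 _) (hu ▸ hm'.1 _)
    subst hmm
    have := (Function.iterate_injOn_Iio_minimalPeriod (f := s) (x := m)) hm.2 hm'.2 h
    subst this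
    rfl
  · intro x _
    obtain ⟨m, hm, hmin⟩ := Set.exists_min_image (Set.range fun t : ℕ => s^[t] x) id
      (Set.toFinite _) ⟨x, 0, rfl⟩
    obtain ⟨t, rfl⟩ := hm
    obtain ⟨u, hu⟩ := exists_iterate_iterate_eq hs x t
    have hp : 0 < Function.minimalPeriod s (s^[t] x) :=
      Function.minimalPeriod_pos_of_mem_periodicPts (hs.mem_periodicPts _)
    refine ⟨⟨s^[t] x, u % Function.minimalPeriod s (s^[t] x)⟩, ?_, ?_⟩
    · simp only [orbitMins, Finset.mem_sigma, Finset.mem_filter, Finset.mem_univ, true_and,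
        Finset.mem_range]
      refine ⟨fun r => ?_, Nat.mod_lt _ hp⟩
      rw [← Function.iterate_add_apply]
      exact hmin _ ⟨_, rfl⟩
    · simp only [Function.iterate_mod_minimalPeriod_eq, hu]

/-- The cyclic successor in a finite linear order. -/
def IsCyclicSucc {α : Type*} [LinearOrder α] (n : α → α) : Prop :=
  ∀ i, (i < n i ∧ ∀ j, i < j → n i ≤ j) ∨ ∀ j, n i ≤ j ∧ j ≤ i

lemma IsCyclicSucc.injective {α : Type*} [LinearOrder α] {n : α → α} (hn : IsCyclicSucc n) :
    Function.Injective n := by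
  intro i j h
  rcases hn i with ⟨h1, h2⟩ | h1 <;> rcases hn j with ⟨h3, h4⟩ | h3
  · rcases lt_trichotomy i j with hij | hij | hij
    · exact absurd (h2 j hij) (by rw [h]; exact not_le.2 h3)
    · exact hij
    · exact absurd (h4 i hij) (by rw [← h]; exact not_le.2 h1)
  · exact absurd (h3 i).1 (by rw [← h]; exact not_le.2 h1)
  · exact absurd (h1 j).1 (by rw [h]; exact not_le.2 h3)
  · exact le_antisymm (h3 i).2 (h1 j).2

/-- A non-crossing perfect matching on `2 a` cyclically ordered points has `a + 1` regions. -/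
lemma two_mul_card_orbitMins {α : Type*} [Fintype α] [LinearOrder α] [Nonempty α] {n τ : α → α}
    (hn : IsCyclicSucc n) (hτ : Function.Involutive τ) (hne : ∀ x, τ x ≠ x)
    (hcross : ∀ x y, ¬(x < y ∧ y < τ x ∧ τ x < τ y)) :
    2 * (orbitMins (τ ∘ n)).card = Fintype.card α + 2 := by
  obtain ⟨b, hb⟩ : ∃ b : α, ∀ x, b ≤ x := Finite.exists_min id
  have hinj : Function.Injective (τ ∘ n) := hτ.injective.comp hn.injective
  have key : orbitMins (τ ∘ n) = insert (τ b) (Finset.univ.filter fun x => x < τ x) := by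
    ext m
    simp only [orbitMins, Finset.mem_filter, Finset.mem_univ, true_and, Finset.mem_insert]
    constructor
    · intro hm
      by_contra! hc
      have hlt : τ m < m := lt_of_le_of_ne hc.2 (hne m)
      obtain ⟨p, hp⟩ := (Finite.injective_iff_surjective.1 hn.injective) (τ m)
      have hpm : (τ ∘ n) p = m := by simp [hp, hτ m]
      have hpl : p < τ m := by
        rcases hn p with ⟨h1, -⟩ | h1
        · rwa [hp] at h1
        · exfalso
          have : τ m = b := le_antisymm (by rw [← hp]; exact (h1 b).1) (hb _)
          exact hc.1 (by rw [← this, hτ m])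
      obtain ⟨u, hu⟩ := exists_iterate_iterate_eq hinj p 1
      rw [Function.iterate_one, hpm] at hu
      have := hm u
      rw [hu] at this
      exact absurd this (not_le.2 (hpl.trans hlt))
    · rintro (rfl | hm) t
      · suffices h : ∀ t, τ b ≤ (τ ∘ n)^[t] (τ b) from h t
        intro t
        induction t with
        | zero => exact le_rfl
        | succ t ih =>
          rw [Function.iterate_succ_apply']
          generalize (τ ∘ n)^[t] (τ b) = i at ih
          simp only [Function.comp_apply]
          rcases hn i with ⟨h1, -⟩ | h1
          · by_contra! hlt
            refine hcross b (τ (n i)) ⟨lt_of_le_of_ne (hb _) ?_, hlt, ?_⟩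
            · intro h
              have : n i = τ b := by rw [h, hτ]
              exact absurd (this ▸ h1) (not_lt.2 ih)
            · rw [hτ]
              exact lt_of_le_of_lt ih h1
          · have : n i = b := le_antisymm (h1 b).1 (hb _)
            rw [this]
      · suffices h : ∀ t, m ≤ (τ ∘ n)^[t] m ∧ (τ ∘ n)^[t] m < τ m from (h t).1
        intro t
        induction t with
        | zero => exact ⟨le_rfl, hm⟩
        | succ t ih =>
          rw [Function.iterate_succ_apply']
          generalize (τ ∘ n)^[t] m = i at ih
          simp only [Function.comp_apply]
          rcases hn i with ⟨h1, h2⟩ | h1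
          · rcases eq_or_lt_of_le (h2 _ ih.2) with h | h
            · rw [h, hτ]
              exact ⟨le_rfl, hm⟩
            · have hmn : m < n i := ih.1.trans_lt h1
              refine ⟨?_, ?_⟩
              · by_contra! hlt
                exact hcross (τ (n i)) m ⟨hlt, by rw [hτ]; exact hmn, by rw [hτ]; exact h⟩
              · by_contra! hle
                rcases eq_or_lt_of_le hle with h' | h'
                · exact hmn.ne (hτ.injective h')
                · exact hcross m (n i) ⟨hmn, h, h'⟩
          · exact absurd (h1 (τ m)).2 (not_le.2 ih.2)
  have hcard : (Finset.univ.filter fun x => x < τ x).card =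
      (Finset.univ.filter fun x => ¬ x < τ x).card := by
    refine Finset.card_bij (fun x _ => τ x) ?_ (fun x _ y _ h => hτ.injective h) ?_
    · intro x hx
      simp only [Finset.mem_filter, Finset.mem_univ, true_and, hτ x] at hx ⊢
      exact hx.not_gt
    · intro y hy
      refine ⟨τ y, ?_, hτ y⟩
      simp only [Finset.mem_filter, Finset.mem_univ, true_and, hτ y] at hy ⊢
      exact lt_of_le_of_ne (not_lt.1 hy) (hne y)
  have htot := Finset.card_filter_add_card_filter_not (s := (Finset.univ : Finset α))
    (fun x => x < τ x)
  rw [key, Finset.card_insert_of_notMem (by simp [hτ b, hb]), ← Finset.card_univ]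
  omega

end Orbits

section Segments

lemma ecSegment_shape {k : ℕ} {f : ℤ → ℤ × ℤ} (hper : Function.Periodic f (k : ℤ)) {i n j : ℤ}
    (hd : 0 < (n - i) % (k : ℤ)) (hne : f n ≠ f j) (hh : (f n).2 = (f j).2) :
    ∃ r, (subwalkList k f i n).dropLast ++ (horizPath (f n) (f j)).dropLast =
      f i :: f (i + 1) :: r := by
  obtain ⟨d, hd'⟩ : ∃ d, ((n - i) % (k : ℤ)).toNat = d + 1 :=
    ⟨((n - i) % (k : ℤ)).toNat - 1, by omega⟩
  obtain ⟨r, hr⟩ := horizPath_eq_cons hne hh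
  rw [subwalkList_eq, hd', List.range_succ, hr, List.map_append, List.map_singleton,
    List.dropLast_concat, List.range_succ_eq_map]
  rcases d with _ | d
  · have h1 : f (i + 1) = f n := by
      have h2 := hper.int_mul ((n - i) / k) (i + 1)
      rw [← h2]
      congr 1
      have := Int.emod_add_mul_ediv (n - i) k
      rw [mul_comm, Int.cast_id]
      omega
    simp [h1]
  · simp [List.range_succ_eq_map]

lemma tripleSum_ecSegment (F : ℤ × ℤ → ℤ × ℤ → ℤ × ℤ → ℤ) {k : ℕ} {f : ℤ → ℤ × ℤ}
    (hper : Function.Periodic f (k : ℤ)) {i n j : ℤ} (hd : 0 < (n - i) % (k : ℤ))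
    (hne : f n ≠ f j) (hh : (f n).2 = (f j).2) :
    tripleSum F ((subwalkList k f i n).dropLast ++ (horizPath (f n) (f j)).dropLast ++
        [f j, f (j + 1)]) =
      ∑ t ∈ Finset.range (((n - i) % (k : ℤ)).toNat - 1),
        F (f (i + t)) (f (i + t + 1)) (f (i + t + 1 + 1)) +
      F (f (n - 1)) (f n) (towards (f n) (f j)) + tripleSum F (horizPath (f n) (f j)) +
      F (towards (f j) (f n)) (f j) (f (j + 1)) := by
  obtain ⟨d, hd'⟩ : ∃ d, ((n - i) % (k : ℤ)).toNat = d + 1 :=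
    ⟨((n - i) % (k : ℤ)).toNat - 1, by omega⟩
  have hshift : ∀ z, f (i + (d + 1) + z) = f (n + z) := by
    intro z
    rw [← hper.int_mul ((n - i) / k) (i + (d + 1) + z)]
    congr 1
    have := Int.emod_add_mul_ediv (n - i) k
    rw [mul_comm, Int.cast_id]
    omega
  have h1 : f (i + d) = f (n - 1) := by
    rw [sub_eq_add_neg, ← hshift]
    congr 1
    ring
  have h2 : f (i + (d + 1)) = f n := by simpa using hshift 0
  obtain ⟨r, hr⟩ := horizPath_eq_cons hne hh
  obtain ⟨r', hr'⟩ := horizPath_eq_append hne hh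
  have hlast : (horizPath (f n) (f j)).dropLast ++ [f j, f (j + 1)] =
      horizPath (f n) (f j) ++ [f (j + 1)] := by
    rw [hr']
    simp
  have hsub : (subwalkList k f i n).dropLast =
      (List.range d).map (fun t : ℕ => f (i + t)) ++ [f (n - 1)] := by
    rw [subwalkList_eq, hd', List.range_succ, List.map_append, List.map_singleton,
      List.dropLast_concat, List.range_succ, List.map_append, List.map_singleton, h1]
  have hmap : (List.range d).map (fun t : ℕ => f (i + t)) ++ [f (n - 1), f n] =
      (List.range (d + 2)).map (fun t : ℕ => f (i + t)) := by
    simp [List.range_succ, h1, h2]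
  have hA : tripleSum F (horizPath (f n) (f j) ++ [f (j + 1)]) =
      tripleSum F (horizPath (f n) (f j)) + F (towards (f j) (f n)) (f j) (f (j + 1)) := by
    rw [hr', tripleSum_append_singleton]
  have hB : tripleSum F (f (n - 1) :: (horizPath (f n) (f j) ++ [f (j + 1)])) =
      F (f (n - 1)) (f n) (towards (f n) (f j)) +
        tripleSum F (horizPath (f n) (f j) ++ [f (j + 1)]) := by
    rw [hr]
    rfl
  have hC : tripleSum F ((List.range d).map (fun t : ℕ => f (i + t)) ++
      f (n - 1) :: (horizPath (f n) (f j) ++ [f (j + 1)])) =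
      tripleSum F ((List.range (d + 2)).map (fun t : ℕ => f (i + t))) +
        tripleSum F (f (n - 1) :: (horizPath (f n) (f j) ++ [f (j + 1)])) := by
    rw [← hmap, hr]
    exact tripleSum_append F _ _ _ _
  rw [List.append_assoc, hlast, hsub, List.append_assoc, List.singleton_append, hC, hB, hA,
    tripleSum_map_range, hd']
  simp only [Nat.add_sub_cancel]
  push_cast
  simp only [add_assoc, one_add_one_eq_two]

end Segments

section PAIndices

/-- The type of PA-indices. -/
abbrev PAIdx (k : ℕ) (f : ℤ → ℤ × ℤ) : Type := {i : ℤ // IsPAIndex k f i}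

instance (k : ℕ) (f : ℤ → ℤ × ℤ) : Finite (PAIdx k f) :=
  Set.Finite.subset (Set.finite_Ico (0 : ℤ) k) (fun _ hi => ⟨hi.1, hi.2.1⟩)

noncomputable instance (k : ℕ) (f : ℤ → ℤ × ℤ) : Fintype (PAIdx k f) := Fintype.ofFinite _

lemma nextPA_spec {k : ℕ} {f : ℤ → ℤ × ℤ} (h : Nonempty (PAIdx k f)) (i : ℤ) :
    IsPAIndex k f (nextPA k f i) ∧ ∀ j, IsPAIndex k f j →
      (nextPA k f i - i - 1) % (k : ℤ) ≤ (j - i - 1) % (k : ℤ) := by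
  have hex : ∃ j : ℤ, IsPAIndex k f j ∧ ∀ j' : ℤ, IsPAIndex k f j' →
      (j - i - 1) % (k : ℤ) ≤ (j' - i - 1) % (k : ℤ) := by
    obtain ⟨j, hj⟩ := Finite.exists_min fun j : PAIdx k f => ((j : ℤ) - i - 1) % (k : ℤ)
    exact ⟨j, j.2, fun j' hj' => hj ⟨j', hj'⟩⟩
  rw [nextPA, dif_pos hex]
  exact hex.choose_spec

/-- The next PA-index, as a self-map of the PA-indices. -/
noncomputable def nextIdx {k : ℕ} {f : ℤ → ℤ × ℤ} (i : PAIdx k f) : PAIdx k f :=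
  ⟨nextPA k f i, (nextPA_spec ⟨i⟩ i).1⟩

lemma sub_emod_of_lt {k a b : ℤ} (hb : 0 ≤ b) (hak : a < k) (h : b < a) : (a - b) % k = a - b :=
  Int.emod_eq_of_lt (by omega) (by omega)

lemma sub_emod_of_le {k a b : ℤ} (ha : 0 ≤ a) (hbk : b < k) (h : a < b) :
    (a - b) % k = a - b + k := by
  rw [← Int.add_emod_right]
  exact Int.emod_eq_of_lt (by omega) (by omega)

lemma sub_sub_one_emod {k a b : ℤ} (ha : 0 ≤ a) (hak : a < k) (hb : 0 ≤ b) (hbk : b < k) :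
    (a - b - 1) % k = if b < a then a - b - 1 else a - b - 1 + k := by
  split_ifs
  · exact Int.emod_eq_of_lt (by omega) (by omega)
  · rw [← Int.add_emod_right]
    exact Int.emod_eq_of_lt (by omega) (by omega)

lemma isCyclicSucc_nextIdx (k : ℕ) (f : ℤ → ℤ × ℤ) : IsCyclicSucc (nextIdx (k := k) (f := f)) := by
  intro i
  have hi := i.2
  have hn := (nextIdx i).2
  have hspec : ∀ j : PAIdx k f, ((nextIdx i : ℤ) - i - 1) % (k : ℤ) ≤ ((j : ℤ) - i - 1) % (k : ℤ) :=
    fun j => (nextPA_spec ⟨i⟩ i).2 j j.2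
  simp only [← Subtype.coe_lt_coe, ← Subtype.coe_le_coe]
  by_cases h : (i : ℤ) < nextIdx i
  · refine Or.inl ⟨h, fun j hj => ?_⟩
    have := hspec j
    rw [sub_sub_one_emod hn.1 hn.2.1 hi.1 hi.2.1, sub_sub_one_emod j.2.1 j.2.2.1 hi.1 hi.2.1,
      if_pos h, if_pos hj] at this
    omega
  · refine Or.inr fun j => ?_
    have := hspec j
    have h1 := j.2.2.1
    have h2 := hn.1
    rw [sub_sub_one_emod hn.1 hn.2.1 hi.1 hi.2.1, sub_sub_one_emod j.2.1 j.2.2.1 hi.1 hi.2.1,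
      if_neg h] at this
    split_ifs at this <;> omega

/-- The number of edges of the walk between a PA-index and the next one. -/
noncomputable def arcLen {k : ℕ} {f : ℤ → ℤ × ℤ} (i : PAIdx k f) : ℕ :=
  (((nextIdx i : ℤ) - i) % (k : ℤ)).toNat

/-- The arcs between consecutive PA-indices cover the closed walk once. -/
lemma sum_arcs {k : ℕ} {f : ℤ → ℤ × ℤ} [hα : Nontrivial (PAIdx k f)] {h : ℤ → ℤ}
    (hper : Function.Periodic h (k : ℤ)) :
    ∑ i : PAIdx k f, ∑ t ∈ Finset.range (arcLen i), h (i + t) =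
      ∑ t ∈ Finset.range k, h t := by
  set pre : ℕ → ℤ := fun s => ∑ t ∈ Finset.range s, h t with hpre
  have hadd : ∀ a b : ℕ, ∑ t ∈ Finset.range b, h (a + t) = pre (a + b) - pre a := by
    intro a b
    simp only [hpre, Finset.sum_range_add]
    push_cast
    ring
  have hprek : ∀ a : ℕ, pre (k + a) = pre k + pre a := by
    intro a
    simp only [hpre, Finset.sum_range_add]
    congr 1
    refine Finset.sum_congr rfl fun t _ => ?_
    push_cast
    rw [add_comm, hper]
  have hsucc := isCyclicSucc_nextIdx k f
  have harc : ∀ i : PAIdx k f, ∑ t ∈ Finset.range (arcLen i), h (i + t) =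
      pre (nextIdx i : ℤ).toNat - pre (i : ℤ).toNat + if nextIdx i ≤ i then pre k else 0 := by
    intro i
    have hi := i.2.1
    have hik := i.2.2.1
    have hn := (nextIdx i).2.1
    have hnk := (nextIdx i).2.2.1
    have h1 := hadd (i : ℤ).toNat (arcLen i)
    rw [Int.toNat_of_nonneg hi] at h1
    rw [h1]
    split_ifs with h2
    · have h3 : (nextIdx i : ℤ) < i := by
        refine lt_of_le_of_ne h2 fun h3 => ?_
        have h4 : nextIdx i = i := Subtype.ext h3
        rcases hsucc i with h5 | h5
        · exact absurd h5.1 (by rw [h4]; exact lt_irrefl i)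
        · obtain ⟨j, hj⟩ := exists_ne i
          exact hj (le_antisymm (h5 j).2 (by have := (h5 j).1; rwa [h4] at this))
      rw [arcLen, sub_emod_of_le hn hik h3,
        show (i : ℤ).toNat + ((nextIdx i : ℤ) - i + k).toNat = k + (nextIdx i : ℤ).toNat by omega,
        hprek]
      ring
    · have h3 : (i : ℤ) < nextIdx i := not_le.1 h2
      rw [arcLen, sub_emod_of_lt hi hnk h3,
        show (i : ℤ).toNat + ((nextIdx i : ℤ) - i).toNat = (nextIdx i : ℤ).toNat by omega]
      ring
  have hbij : Function.Bijective (nextIdx (k := k) (f := f)) :=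
    Finite.injective_iff_bijective.1 hsucc.injective
  obtain ⟨M, hM⟩ := Finite.exists_max (id : PAIdx k f → PAIdx k f)
  have hwrap : ∀ i : PAIdx k f, nextIdx i ≤ i ↔ i = M := by
    intro i
    constructor
    · intro h1
      rcases hsucc i with h2 | h2
      · exact absurd h1 (not_le.2 h2.1)
      · exact le_antisymm (hM i) (h2 M).2
    · rintro rfl
      exact hM _
  rw [Finset.sum_congr rfl fun i _ => harc i, Finset.sum_add_distrib, Finset.sum_sub_distrib,
    hbij.sum_comp fun i : PAIdx k f => pre (i : ℤ).toNat]
  simp only [hwrap]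
  simp [hpre]

end PAIndices

section Pairing

/-- The matching on the PA-indices given by a proper assignment set. -/
structure Pairing (k : ℕ) (f : ℤ → ℤ × ℤ) (A : Set (Finset ℤ)) where
  partner : PAIdx k f → PAIdx k f
  mem_iff : ∀ i j : PAIdx k f, ({(i : ℤ), (j : ℤ)} : Finset ℤ) ∈ A ↔ j = partner i
  ne : ∀ i : PAIdx k f, f i ≠ f (partner i)
  height : ∀ i : PAIdx k f, (f i).2 = (f (partner i)).2
  avoid : ∀ i : PAIdx k f, towards (f i) (f (partner i)) ≠ f (i - 1) ∧
    towards (f i) (f (partner i)) ≠ f (i + 1)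

variable {k : ℕ} {f : ℤ → ℤ × ℤ} {A : Set (Finset ℤ)}

lemma exists_partner (hA : IsProperAssignment k f A) (i : PAIdx k f) :
    ∃ j : PAIdx k f, ({(i : ℤ), (j : ℤ)} : Finset ℤ) ∈ A ∧ f i ≠ f j ∧ (f i).2 = (f j).2 ∧
      towards (f i) (f j) ≠ f (i - 1) ∧ towards (f i) (f j) ≠ f (i + 1) := by
  obtain ⟨p, ⟨hp, hip⟩, -⟩ := hA.2.1 i i.2
  obtain ⟨x, y, rfl, hx, hy, hne, hh, hav⟩ := hA.1 p hp
  rcases Finset.mem_insert.1 hip with h | h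
  · obtain ⟨r, hr⟩ := horizPath_eq_cons hne hh
    have h1 := hav (towards (f x) (f y)) (by simp [hr])
    refine ⟨⟨y, hy⟩, ?_⟩
    rw [h]
    exact ⟨hp, hne, hh, h1.1, h1.2.1⟩
  · have h := Finset.mem_singleton.1 h
    obtain ⟨r, hr⟩ := horizPath_eq_append hne hh
    have h1 := hav (towards (f y) (f x)) (by simp [hr])
    refine ⟨⟨x, hx⟩, ?_⟩
    rw [h]
    exact ⟨Finset.pair_comm x y ▸ hp, hne.symm, hh.symm, h1.2.2.1, h1.2.2.2⟩

lemma nonempty_pairing (hA : IsProperAssignment k f A) : Nonempty (Pairing k f A) := by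
  choose τ hmem hne hh hav using exists_partner hA
  refine ⟨⟨τ, fun i j => ⟨fun h => ?_, fun h => h ▸ hmem i⟩, hne, hh, hav⟩⟩
  have h1 := (hA.2.1 i i.2).unique ⟨h, by simp⟩ ⟨hmem i, by simp⟩
  have h2 : (τ i : ℤ) ∈ ({(i : ℤ), (j : ℤ)} : Finset ℤ) := by simp [h1]
  have h3 : (τ i : ℤ) ≠ i := fun h => hne i (by rw [h])
  simp only [Finset.mem_insert, Finset.mem_singleton, h3, false_or] at h2
  exact Subtype.ext h2.symm

namespace Pairing

lemma involutive (P : Pairing k f A) : Function.Involutive P.partner := by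
  intro i
  have h := (P.mem_iff i _).2 rfl
  rw [Finset.pair_comm] at h
  exact ((P.mem_iff _ _).1 h).symm

lemma partner_ne (P : Pairing k f A) (i : PAIdx k f) : P.partner i ≠ i :=
  fun h => P.ne i (by rw [h])

/-- The successor of an index in its elementary cycle. -/
noncomputable def step (P : Pairing k f A) : PAIdx k f → PAIdx k f := P.partner ∘ nextIdx

lemma step_injective (P : Pairing k f A) : Function.Injective P.step :=
  P.involutive.injective.comp (isCyclicSucc_nextIdx k f).injective

lemma two_mul_card (P : Pairing k f A) (hA : IsProperAssignment k f A) [Nonempty (PAIdx k f)] :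
    2 * (orbitMins P.step).card = Fintype.card (PAIdx k f) + 2 := by
  refine two_mul_card_orbitMins (isCyclicSucc_nextIdx k f) P.involutive P.partner_ne ?_
  rintro x y ⟨h1, h2, h3⟩
  exact hA.2.2 _ ((P.mem_iff x _).2 rfl) _ ((P.mem_iff y _).2 rfl) x (by simp) (P.partner x)
    (by simp) y (by simp) (P.partner y) (by simp) ⟨h1, h2, h3⟩

lemma nontrivial (P : Pairing k f A) [Nonempty (PAIdx k f)] : Nontrivial (PAIdx k f) :=
  ⟨Classical.arbitrary _, P.partner (Classical.arbitrary _), (P.partner_ne _).symm⟩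

lemma nextIdx_ne (P : Pairing k f A) (i : PAIdx k f) : nextIdx i ≠ i := by
  intro h
  rcases isCyclicSucc_nextIdx k f i with h1 | h1
  · exact absurd h1.1 (by rw [h]; exact lt_irrefl i)
  · refine P.partner_ne i (le_antisymm (h1 _).2 ?_)
    have := (h1 (P.partner i)).1
    rwa [h] at this

lemma arcLen_pos (P : Pairing k f A) (i : PAIdx k f) : 0 < ((nextIdx i : ℤ) - i) % (k : ℤ) := by
  rcases lt_trichotomy (nextIdx i : ℤ) i with h | h | h
  · rw [sub_emod_of_le (nextIdx i).2.1 i.2.2.1 h]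
    have := (nextIdx i).2.1
    have := i.2.2.1
    omega
  · exact absurd (Subtype.ext h) (P.nextIdx_ne i)
  · rw [sub_emod_of_lt i.2.1 (nextIdx i).2.2.1 h]
    omega

/-- The contribution to `F`-sums of the segment of an elementary cycle that starts at `i`. -/
noncomputable def segSum (P : Pairing k f A) (F : ℤ × ℤ → ℤ × ℤ → ℤ × ℤ → ℤ)
    (i : PAIdx k f) : ℤ :=
  ∑ t ∈ Finset.range (arcLen i - 1), F (f (i + t)) (f (i + t + 1)) (f (i + t + 1 + 1)) +
    F (f (nextIdx i - 1)) (f (nextIdx i)) (towards (f (nextIdx i)) (f (P.step i))) +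
    tripleSum F (horizPath (f (nextIdx i)) (f (P.step i))) +
    F (towards (f (P.step i)) (f (nextIdx i))) (f (P.step i)) (f (P.step i + 1))

lemma corner (P : Pairing k f A) (hW : IsClosedWalk k f) (i : PAIdx k f) :
    let h := towards (f i) (f (P.partner i))
    turn (f (i - 1)) (f i) (f (i + 1)) = -1 ∧ turn (f (i - 1)) (f i) h = 1 ∧
      turn h (f i) (f (i + 1)) = 1 ∧ Good (f (i - 1)) (f i) h ∧ Good h (f i) (f (i + 1)) :=
  turn_of_left (by simpa using hW.2.2.1 (i - 1)) (hW.2.2.1 i) (hW.2.2.2 i) i.2.2.2.1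
    (bwAdj_towards _ _) (P.avoid i).1 (P.avoid i).2

lemma segSum_turn (P : Pairing k f A) (hW : IsClosedWalk k f) (i : PAIdx k f) :
    P.segSum turn i =
      ∑ t ∈ Finset.range (arcLen i), turn (f (i + t - 1)) (f (i + t)) (f (i + t + 1)) + 3 +
        tripleSum turn (horizPath (f (nextIdx i)) (f (P.partner (nextIdx i)))) := by
  obtain ⟨d, hd⟩ : ∃ d, arcLen i = d + 1 :=
    ⟨arcLen i - 1, by have := P.arcLen_pos i; unfold arcLen; omega⟩
  have h1 := (P.corner hW (nextIdx i)).2.1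
  have h2 := (P.corner hW (P.step i)).2.2.1
  have h3 := (P.corner hW i).1
  rw [show P.partner (P.step i) = nextIdx i from P.involutive _] at h2
  rw [segSum, h2, hd, Finset.sum_range_succ']
  simp only [step, Function.comp_apply, Nat.add_sub_cancel, Nat.cast_zero, add_zero, h3]
  rw [h1]
  have h4 : ∀ t : ℕ, (i : ℤ) + ((t + 1 : ℕ) : ℤ) = i + t + 1 := by
    intro t
    push_cast
    ring
  simp only [h4, add_sub_cancel_right]
  ring

lemma sum_segSum_turn (P : Pairing k f A) (hW : IsClosedWalk k f) [Nonempty (PAIdx k f)] :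
    ∑ i, P.segSum turn i = cycSum turn k f + 3 * Fintype.card (PAIdx k f) := by
  have := P.nontrivial
  have hper : Function.Periodic (fun z => turn (f (z - 1)) (f z) (f (z + 1))) (k : ℤ) := by
    intro z
    simp only
    rw [hW.2.1, add_sub_right_comm, hW.2.1, add_right_comm, hW.2.1]
  have hH : ∑ i : PAIdx k f,
      tripleSum turn (horizPath (f (nextIdx i)) (f (P.partner (nextIdx i)))) = 0 := by
    have hbij : Function.Bijective (nextIdx (k := k) (f := f)) :=
      Finite.injective_iff_bijective.1 (isCyclicSucc_nextIdx k f).injective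
    rw [hbij.sum_comp fun i : PAIdx k f => tripleSum turn (horizPath (f i) (f (P.partner i)))]
    have h := P.involutive.bijective.sum_comp
      fun i : PAIdx k f => tripleSum turn (horizPath (f i) (f (P.partner i)))
    have h' : ∀ i : PAIdx k f,
        tripleSum turn (horizPath (f (P.partner i)) (f (P.partner (P.partner i)))) =
          -tripleSum turn (horizPath (f i) (f (P.partner i))) := by
      intro i
      rw [P.involutive i, tripleSum_turn_horizPath (P.ne i) (P.height i)]
    simp only [h', Finset.sum_neg_distrib] at h
    omega
  simp only [P.segSum_turn hW, Finset.sum_add_distrib, hH, sum_arcs hper, cycSum]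
  simp
  ring

lemma segSum_badInd (P : Pairing k f A) (hW : IsClosedWalk k f) (i : PAIdx k f) :
    P.segSum badInd i = 0 := by
  have h1 := (P.corner hW (nextIdx i)).2.2.2.1
  have h2 := (P.corner hW (P.step i)).2.2.2.2
  rw [show P.partner (P.step i) = nextIdx i from P.involutive _] at h2
  have hk : (0 : ℤ) < k := by exact_mod_cast hW.1
  have hper : Function.Periodic f (k : ℤ) := hW.2.1
  have h3 : ∀ t ∈ Finset.range (arcLen i - 1),
      badInd (f (i + t)) (f (i + t + 1)) (f (i + t + 1 + 1)) = 0 := by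
    intro t ht
    refine if_pos ?_
    have key := good_of_not_left (f := f) (i := i + t + 1) (by simpa using hW.2.2.1 (i + t))
      (hW.2.2.1 _) (hW.2.2.2 _) ?_
    · simpa using key
    · intro hleft
      set s : ℤ := i + t + 1 with hs
      have hmod : ∀ z, f (s % k + z) = f (s + z) := by
        intro z
        rw [← hper.int_mul (s / k) (s % k + z)]
        congr 1
        have := Int.emod_add_mul_ediv s k
        rw [mul_comm, Int.cast_id]
        omega
      have hm0 : f (s % k) = f s := by simpa using hmod 0
      have hm1 : f (s % k + 1) = f (s + 1) := hmod 1
      have hm2 : f (s % k - 1) = f (s - 1) := hmod (-1)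
      have hpa : IsPAIndex k f (s % k) := by
        refine ⟨Int.emod_nonneg _ hk.ne', Int.emod_lt_of_pos _ hk, ?_⟩
        simp only [LeftTurn, thirdNb, hm0, hm1, hm2] at hleft ⊢
        exact hleft
      have hle := (nextPA_spec ⟨i⟩ i).2 _ hpa
      have hpos := P.arcLen_pos i
      have hlt := Int.emod_lt_of_pos ((nextIdx i : ℤ) - i) hk
      have ht' := Finset.mem_range.1 ht
      rw [arcLen] at ht'
      have e1 : (s % k - i - 1) % (k : ℤ) = t := by
        rw [sub_sub, Int.emod_sub_emod, hs, show (i : ℤ) + t + 1 - (i + 1) = t by ring]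
        exact Int.emod_eq_of_lt (by omega) (by omega)
      have e2 : (nextPA k f i - i - 1) % (k : ℤ) = ((nextIdx i : ℤ) - i) % k - 1 := by
        rw [← Int.emod_sub_emod]
        exact Int.emod_eq_of_lt (by simp only [nextIdx] at hpos ⊢; omega)
          (by simp only [nextIdx] at hlt ⊢; omega)
      omega
  have b1 : badInd (f (nextIdx i - 1)) (f (nextIdx i))
      (towards (f (nextIdx i)) (f (P.step i))) = 0 := if_pos h1
  have b2 : badInd (towards (f (P.step i)) (f (nextIdx i))) (f (P.step i))
      (f (P.step i + 1)) = 0 := if_pos h2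
  rw [segSum, Finset.sum_eq_zero h3, tripleSum_badInd_horizPath, b1, b2]
  rfl

/-- The index sequence of an elementary cycle is an orbit of `step` from its least element. -/
lemma elemCycle_orbit (P : Pairing k f A) (E : ElemCycle k f A) :
    ∃ e : PAIdx k f, (e : ℤ) = E.idx 0 ∧ e ∈ orbitMins P.step ∧
    Function.minimalPeriod P.step e = E.l + 1 ∧
    ∀ t ≤ E.l + 1, E.idx t = (P.step^[t] e : PAIdx k f) := by
  set e : PAIdx k f := ⟨E.idx 0, E.pa 0 (Nat.zero_le _)⟩ with he
  have hidx : ∀ t ≤ E.l + 1, E.idx t = (P.step^[t] e : PAIdx k f) := by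
    intro t
    induction t with
    | zero => exact fun _ => rfl
    | succ t ih =>
      intro ht
      have h1 := ih (by omega)
      rw [Function.iterate_succ_apply']
      have hpa : IsPAIndex k f (E.idx (t + 1)) := by
        rcases Nat.lt_or_ge t E.l with h | h
        · exact E.pa _ h
        · rw [E.canon _ (by omega)]
          exact e.2
      have hmem : ({nextPA k f (E.idx t), E.idx (t + 1)} : Finset ℤ) ∈ A := by
        rcases Nat.lt_or_ge t E.l with h | h
        · exact E.mem t h
        · obtain rfl : t = E.l := by omega
          rw [E.canon (E.l + 1) (by omega)]
          exact E.memLast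
      rw [h1] at hmem
      have := (P.mem_iff (nextIdx (P.step^[t] e)) ⟨_, hpa⟩).1 hmem
      exact congrArg Subtype.val this
  have hperiod : Function.IsPeriodicPt P.step (E.l + 1) e :=
    Subtype.ext (by rw [← hidx _ le_rfl, E.canon _ (by omega)])
  have hmin : Function.minimalPeriod P.step e = E.l + 1 := by
    refine le_antisymm (hperiod.minimalPeriod_le (by omega)) ?_
    by_contra! hlt
    have hpos := hperiod.minimalPeriod_pos (by omega)
    have h1 := hidx _ hlt.le
    rw [Function.iterate_minimalPeriod] at h1
    exact absurd (E.minimal _ hpos (by omega)) (by rw [h1]; exact lt_irrefl _)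
  refine ⟨e, rfl, ?_, hmin, hidx⟩
  simp only [orbitMins, Finset.mem_filter, Finset.mem_univ, true_and]
  intro t
  rw [← Function.iterate_mod_minimalPeriod_eq, hmin]
  have hlt : t % (E.l + 1) < E.l + 1 := Nat.mod_lt _ (Nat.succ_pos _)
  rw [← Subtype.coe_le_coe, ← hidx _ hlt.le]
  rcases Nat.eq_zero_or_pos (t % (E.l + 1)) with h | h
  · rw [h]
  · exact (E.minimal _ h (by omega)).le

/-- Each least element of an orbit of `step` starts an elementary cycle. -/
lemma exists_elemCycle (P : Pairing k f A) {m : PAIdx k f} (hm : m ∈ orbitMins P.step) :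
    ∃ E : ElemCycle k f A, E.idx 0 = m := by
  simp only [orbitMins, Finset.mem_filter, Finset.mem_univ, true_and] at hm
  have hpos : 0 < Function.minimalPeriod P.step m :=
    Function.minimalPeriod_pos_of_mem_periodicPts (P.step_injective.mem_periodicPts m)
  obtain ⟨l, hl⟩ : ∃ l, Function.minimalPeriod P.step m = l + 1 :=
    ⟨Function.minimalPeriod P.step m - 1, by omega⟩
  have hmem : ∀ t, ({nextPA k f (P.step^[t] m : PAIdx k f), ((P.step^[t + 1] m : PAIdx k f) : ℤ)} :
      Finset ℤ) ∈ A := by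
    intro t
    rw [Function.iterate_succ_apply']
    exact (P.mem_iff (nextIdx (P.step^[t] m)) _).2 rfl
  refine ⟨⟨l, fun t => if t ≤ l then (P.step^[t] m : PAIdx k f) else m, ?_, ?_, ?_, ?_, ?_⟩, ?_⟩
  · intro t ht
    simp only [ht, if_true]
    exact (P.step^[t] m).2
  · intro t ht
    simp only [ht.le, if_true, Nat.succ_le_of_lt ht]
    exact hmem t
  · have := hmem l
    rw [← hl, Function.iterate_minimalPeriod] at this
    simpa using this
  · intro t h1 ht
    simp only [ht, if_true, Nat.zero_le, Function.iterate_zero, id]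
    refine lt_of_le_of_ne (hm t) fun h => ?_
    exact Function.not_isPeriodicPt_of_pos_of_lt_minimalPeriod (by omega) (by omega)
      (Subtype.ext h.symm)
  · intro t ht
    simp [not_le.2 ht]
  · simp

lemma ecSegment_eq (P : Pairing k f A) (E : ElemCycle k f A)
    {e : PAIdx k f} (he : ∀ t ≤ E.l + 1, E.idx t = (P.step^[t] e : PAIdx k f))
    {t : ℕ} (ht : t ≤ E.l) : ecSegment E t =
      (subwalkList k f (P.step^[t] e : PAIdx k f) (nextIdx (P.step^[t] e))).dropLast ++
        (horizPath (f (nextIdx (P.step^[t] e))) (f (P.step (P.step^[t] e)))).dropLast := by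
  have h1 : E.idx (if t = E.l then 0 else t + 1) = P.step (P.step^[t] e) := by
    rw [← Function.iterate_succ_apply' P.step, ← he _ (by omega)]
    split_ifs with h
    · rw [E.canon (t + 1) (by omega)]
    · rfl
  rw [ecSegment, h1, he t (by omega)]
  rfl

lemma ecSegment_eq_cons (P : Pairing k f A) (E : ElemCycle k f A)
    (hW : IsClosedWalk k f) {t : ℕ} (ht : t ≤ E.l) :
    ∃ r, ecSegment E t = f (E.idx t) :: f (E.idx t + 1) :: r := by
  obtain ⟨e, -, -, -, he⟩ := P.elemCycle_orbit E
  rw [P.ecSegment_eq E he ht, he t (by omega)]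
  exact ecSegment_shape hW.2.1 (P.arcLen_pos _) (P.ne _) (P.height _)

lemma ecOpenList_eq_cons (P : Pairing k f A) (E : ElemCycle k f A)
    (hW : IsClosedWalk k f) :
    ∃ r, ecOpenList E = f (E.idx 0) :: f (E.idx 0 + 1) :: r := by
  obtain ⟨r, hr⟩ := P.ecSegment_eq_cons E hW (Nat.zero_le _)
  rw [ecOpenList, List.range_succ_eq_map, List.flatMap_cons, hr]
  exact ⟨_, rfl⟩

lemma cycSum_elemCycle (P : Pairing k f A) (E : ElemCycle k f A)
    (hW : IsClosedWalk k f) (F : ℤ × ℤ → ℤ × ℤ → ℤ × ℤ → ℤ)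
    {e : PAIdx k f} (he : ∀ t ≤ E.l + 1, E.idx t = (P.step^[t] e : PAIdx k f)) :
    cycSum F (ecLen E) (ecFun E) = ∑ t ∈ Finset.range (E.l + 1), P.segSum F (P.step^[t] e) := by
  have hper : Function.Periodic f (k : ℤ) := hW.2.1
  obtain ⟨r, hr⟩ := P.ecOpenList_eq_cons E hW
  have hflat := tripleSum_flatMap F E.l (ecSegment E) (fun t => f (E.idx t))
    (fun t => f (E.idx t + 1)) fun t ht => P.ecSegment_eq_cons E hW ht
  simp only [E.canon (E.l + 1) (Nat.lt_succ_self _)] at hflat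
  rw [ecLen, ecFun, cycSum_listFun F hr, ecOpenList, hflat]
  refine Finset.sum_congr rfl fun t ht => ?_
  have ht' : t ≤ E.l := Nat.lt_succ_iff.1 (Finset.mem_range.1 ht)
  rw [P.ecSegment_eq E he ht', he (t + 1) (by omega), Function.iterate_succ_apply']
  exact tripleSum_ecSegment F hper (P.arcLen_pos _) (P.ne _) (P.height _)

/-- Elementary cycles have turning number at least one. -/
lemma six_le_cycSum_elemCycle (P : Pairing k f A) (E : ElemCycle k f A)
    (hW : IsClosedWalk k f) :
    6 ≤ cycSum turn (ecLen E) (ecFun E) := by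
  obtain ⟨e, -, -, -, he⟩ := P.elemCycle_orbit E
  have hbad : cycSum badInd (ecLen E) (ecFun E) = 0 := by
    rw [P.cycSum_elemCycle E hW badInd he]
    exact Finset.sum_eq_zero fun t _ => P.segSum_badInd hW _
  have hlen : 0 < ecLen E := by
    obtain ⟨r, hr⟩ := P.ecOpenList_eq_cons E hW
    rw [ecLen, hr]
    exact Nat.succ_pos _
  have hper : Function.Periodic (ecFun E) (ecLen E : ℤ) := by
    intro z
    simp [ecFun, ecLen, listFun]
  refine six_le_cycSum_turn hlen hper fun z => ?_
  have hnonneg : ∀ t ∈ Finset.range (ecLen E),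
      0 ≤ badInd (ecFun E ((t : ℤ) - 1)) (ecFun E t) (ecFun E (t + 1)) := by
    intro t _
    unfold badInd
    split_ifs <;> norm_num
  rw [cycSum, Finset.sum_eq_zero_iff_of_nonneg hnonneg] at hbad
  have hk : (0 : ℤ) < ecLen E := by exact_mod_cast hlen
  have h0 := Int.emod_nonneg z hk.ne'
  have h1 := Int.emod_lt_of_pos z hk
  have h2 := hbad (z % ecLen E).toNat (Finset.mem_range.2 (by omega))
  have hmod : ∀ w, ecFun E (z % ecLen E + w) = ecFun E (z + w) := by
    intro w
    rw [← hper.int_mul (z / ecLen E) (z % ecLen E + w)]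
    congr 1
    have := Int.emod_add_mul_ediv z (ecLen E)
    rw [mul_comm, Int.cast_id]
    omega
  have hm0 : ecFun E (z % ecLen E) = ecFun E z := by simpa using hmod 0
  have hm2 : ecFun E (z % ecLen E - 1) = ecFun E (z - 1) := hmod (-1)
  rw [Int.toNat_of_nonneg h0, hm0, hmod 1, hm2, badInd] at h2
  by_contra h
  simp [h] at h2

end Pairing

end Pairing

/-- Let `A` be a proper assignment set for a closed walk `W` in the
brickwall. Then `t(W) = 1` iff every elementary cycle `C` of `(W, A)` has `t(C) = 1`. -/
theorem turningNumber_one_iff_elemCycles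
    (k : ℕ) (f : ℤ → ℤ × ℤ) (A : Set (Finset ℤ))
    (hW : IsClosedWalk k f) (hA : IsProperAssignment k f A) :
    turningNumber k f = 1 ↔
      ∀ (m : ℕ) (g : ℤ → ℤ × ℤ), IsElemCycleWalk k f A m g → turningNumber m g = 1 := by
  rcases isEmpty_or_nonempty (PAIdx k f) with hα | hα
  · have hno : ∀ i, ¬ IsPAIndex k f i := fun i hi => hα.false ⟨i, hi⟩
    have hAe : A = ∅ := by
      refine Set.eq_empty_of_forall_notMem fun p hp => ?_
      obtain ⟨x, -, -, hx, -⟩ := hA.1 p hp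
      exact hno x hx
    constructor
    · rintro h m g (⟨E, -⟩ | ⟨-, -, rfl, rfl⟩)
      · exact absurd (E.pa 0 (Nat.zero_le _)) (hno _)
      · exact h
    · exact fun h => h k f (Or.inr ⟨hAe, hno, rfl, rfl⟩)
  obtain ⟨P⟩ := nonempty_pairing hA
  set G : PAIdx k f → ℤ := fun m =>
    ∑ t ∈ Finset.range (Function.minimalPeriod P.step m), P.segSum turn (P.step^[t] m) with hG
  have hGE : ∀ E : ElemCycle k f A, ∃ e ∈ orbitMins P.step, (e : ℤ) = E.idx 0 ∧
      cycSum turn (ecLen E) (ecFun E) = G e := by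
    intro E
    obtain ⟨e, h1, h2, h3, h4⟩ := P.elemCycle_orbit E
    exact ⟨e, h2, h1, by simp only [hG, h3, P.cycSum_elemCycle E hW turn h4]⟩
  have hEG : ∀ m ∈ orbitMins P.step, ∃ E : ElemCycle k f A,
      cycSum turn (ecLen E) (ecFun E) = G m := by
    intro m hm
    obtain ⟨E, hE⟩ := P.exists_elemCycle hm
    obtain ⟨e, -, h1, h2⟩ := hGE E
    exact ⟨E, by rw [h2, Subtype.ext (h1.trans hE)]⟩
  have hge : ∀ m ∈ orbitMins P.step, 6 ≤ G m := by
    intro m hm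
    obtain ⟨E, hE⟩ := hEG m hm
    exact hE ▸ P.six_le_cycSum_elemCycle E hW
  have hcount := P.two_mul_card hA
  have hsum : ∑ m ∈ orbitMins P.step, (G m - 6) = cycSum turn k f - 6 := by
    rw [Finset.sum_sub_distrib, sum_orbitMins P.step_injective, P.sum_segSum_turn hW]
    simp only [Finset.sum_const, nsmul_eq_mul]
    omega
  rw [turningNumber_eq_one_iff, ← sub_eq_zero, ← hsum,
    Finset.sum_eq_zero_iff_of_nonneg fun m hm => sub_nonneg.2 (hge m hm)]
  constructor
  · rintro h m g (⟨E, rfl, rfl⟩ | ⟨-, hno, -⟩)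
    · obtain ⟨e, he, -, h1⟩ := hGE E
      rw [turningNumber_eq_one_iff, h1, sub_eq_zero.1 (h e he)]
    · exact absurd hα.some.2 (hno _)
  · intro h m hm
    obtain ⟨E, hE⟩ := hEG m hm
    rw [← hE, (turningNumber_eq_one_iff _ _).1 (h _ _ (Or.inl ⟨E, rfl, rfl⟩)), sub_self]

end Hex
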